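/- arXiv:1607.01164 — 11 statements merged into one kernel-verified Lean document; each statement's English description precedes it below -/
import Mathlib

section
/- Let P be a poset and ≺ an auxiliary relation on P. (1) For any family {A_i : i ∈ I} of lower subsets of P, the upper approximation of ⋂_{i∈I} A_i equals ⋂_{i∈I} A_i^{↑≺}. (2) For any family {B_i : i ∈ I} of upper subsets of P, the lower approximation of ⋃_{i∈I} B_i equals ⋃_{i∈I} B_i^{↓≺}. -/
namespace RoughDomain

variable {P : Type*}

/-- `sRel r x` is the set `s_≺(x) = {y | y ≺ x}`. -/
def sRel [PartialOrder P] (r : P → P → Prop) (x : P) : Set P := {y | r y x}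

/-- An auxiliary relation on a poset. -/
def IsAux [PartialOrder P] (r : P → P → Prop) : Prop :=
  (∀ x y, r x y → x ≤ y) ∧
  (∀ u x y z, u ≤ x → r x y → y ≤ z → r u z) ∧
  (∀ b : P, (∀ p, b ≤ p) → ∀ x, r b x)

/-- The downward closure `↓A`. -/
def dcl [PartialOrder P] (A : Set P) : Set P := {z | ∃ a ∈ A, z ≤ a}

/-- Lower approximation `A^{↓≺} = {x ∈ A | s_≺(x) ∩ A ≠ ∅}`. -/
def lap [PartialOrder P] (r : P → P → Prop) (A : Set P) : Set P :=
  {x | x ∈ A ∧ (sRel r x ∩ A).Nonempty}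

/-- Upper approximation `A^{↑≺} = {x | s_≺(x) ⊆ ↓A}`. -/
def uap [PartialOrder P] (r : P → P → Prop) (A : Set P) : Set P :=
  {x | sRel r x ⊆ dcl A}

/-- A directed subset of a poset (nonempty and upward directed). -/
def IsDir [PartialOrder P] (D : Set P) : Prop :=
  D.Nonempty ∧ DirectedOn (· ≤ ·) D

/-- A pre-approximating auxiliary relation: each `s_≺(x)` is directed. -/
def IsPreApprox [PartialOrder P] (r : P → P → Prop) : Prop :=
  IsAux r ∧ ∀ x, IsDir (sRel r x)

/-- An approximating auxiliary relation: moreover `x = ⋁ s_≺(x)`. -/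
def IsApprox [PartialOrder P] (r : P → P → Prop) : Prop :=
  IsPreApprox r ∧ ∀ x, IsLUB (sRel r x) x

/-- The way-below relation `x ≪ y`. -/
def wb [PartialOrder P] (x y : P) : Prop :=
  ∀ D : Set P, IsDir D → ∀ a, IsLUB D a → y ≤ a → ∃ d ∈ D, x ≤ d

/-- A continuous poset: each `↡x` is directed with supremum `x`. -/
def IsContinuousPoset (P : Type*) [PartialOrder P] : Prop :=
  ∀ x : P, IsDir {y | wb y x} ∧ IsLUB {y | wb y x} x

/-- Scott open sets: upper sets inaccessible by existing directed suprema. -/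
def ScottOpen [PartialOrder P] (U : Set P) : Prop :=
  IsUpperSet U ∧
    ∀ D : Set P, IsDir D → ∀ a, IsLUB D a → a ∈ U → (D ∩ U).Nonempty

/-- The Scott topology on a poset. -/
def scottTop (P : Type*) [PartialOrder P] : TopologicalSpace P where
  IsOpen := ScottOpen
  isOpen_univ :=
    ⟨isUpperSet_univ, fun _D hD _a _ _ => hD.1.imp fun d hd => ⟨hd, trivial⟩⟩
  isOpen_inter := by
    rintro U V ⟨hU1, hU2⟩ ⟨hV1, hV2⟩
    refine ⟨hU1.inter hV1, fun D hD a ha haUV => ?_⟩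
    obtain ⟨d1, hd1D, hd1U⟩ := hU2 D hD a ha haUV.1
    obtain ⟨d2, hd2D, hd2V⟩ := hV2 D hD a ha haUV.2
    obtain ⟨d, hdD, h1, h2⟩ := hD.2 d1 hd1D d2 hd2D
    exact ⟨d, hdD, hU1 h1 hd1U, hV1 h2 hd2V⟩
  isOpen_sUnion := by
    intro S hS
    constructor
    · intro a b hab ha
      obtain ⟨U, hUS, haU⟩ := ha
      exact ⟨U, hUS, (hS U hUS).1 hab haU⟩
    · intro D hD a ha haU
      obtain ⟨U, hUS, haU⟩ := haU
      obtain ⟨d, hdD, hdU⟩ := (hS U hUS).2 D hD a ha haU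
      exact ⟨d, hdD, U, hUS, hdU⟩

lemma lap_subset [PartialOrder P] (r : P → P → Prop) (A : Set P) :
    lap r A ⊆ A := fun _x hx => hx.1

/-- `≺`-open sets: upper sets `U` with `U = U^{↓≺}`. -/
def PrecOpen [PartialOrder P] (r : P → P → Prop) (U : Set P) : Prop :=
  IsUpperSet U ∧ lap r U = U

/-- The topology `μ^≺(P)` of `≺`-open sets, for `≺` pre-approximating. -/
def muTop [PartialOrder P] (r : P → P → Prop) (h : IsPreApprox r) :
    TopologicalSpace P where
  IsOpen := PrecOpen r
  isOpen_univ := by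
    refine ⟨isUpperSet_univ,
      Set.Subset.antisymm (lap_subset r _) fun x _ => ⟨trivial, ?_⟩⟩
    obtain ⟨y, hy⟩ := (h.2 x).1
    exact ⟨y, hy, trivial⟩
  isOpen_inter := by
    rintro U V ⟨hU1, hU2⟩ ⟨hV1, hV2⟩
    refine ⟨hU1.inter hV1,
      Set.Subset.antisymm (lap_subset r _) fun x hx => ?_⟩
    have h1 : x ∈ lap r U := by rw [hU2]; exact hx.1
    have h2 : x ∈ lap r V := by rw [hV2]; exact hx.2
    obtain ⟨y1, hy1r, hy1U⟩ := h1.2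
    obtain ⟨y2, hy2r, hy2V⟩ := h2.2
    obtain ⟨y, hyr, hle1, hle2⟩ := (h.2 x).2 y1 hy1r y2 hy2r
    exact ⟨hx, y, hyr, hU1 hle1 hy1U, hV1 hle2 hy2V⟩
  isOpen_sUnion := by
    intro S hS
    constructor
    · intro a b hab ha
      obtain ⟨U, hUS, haU⟩ := ha
      exact ⟨U, hUS, (hS U hUS).1 hab haU⟩
    · refine Set.Subset.antisymm (lap_subset r _) fun x hx => ?_
      obtain ⟨U, hUS, hxU⟩ := hx
      have h1 : x ∈ lap r U := by rw [(hS U hUS).2]; exact hxU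
      obtain ⟨y, hyr, hyU⟩ := h1.2
      exact ⟨⟨U, hUS, hxU⟩, y, hyr, U, hUS, hyU⟩

/-- A c-space: every point of an open set is in the interior of `↑y`
(with respect to the specialization preorder) for some `y` in that open set. -/
def IsCSpace (X : Type*) [TopologicalSpace X] : Prop :=
  ∀ x : X, ∀ U : Set X, IsOpen U → x ∈ U →
    ∃ y ∈ U, x ∈ interior {z | ∀ V : Set X, IsOpen V → y ∈ V → z ∈ V}

/-- Complete distributivity of a complete lattice. -/
def CompletelyDistrib (L : Type*) [CompleteLattice L] : Prop :=
  ∀ {ι : Type*} {κ : ι → Type*} (f : ∀ i : ι, κ i → L),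
    ⨅ i, ⨆ j, f i j = ⨆ g : ∀ i, κ i, ⨅ i, f i (g i)

/-- `A' `: the set of suprema of directed subsets of `↓A`. -/
def oneStep [PartialOrder P] (A : Set P) : Set P :=
  {x | ∃ D : Set P, IsDir D ∧ D ⊆ dcl A ∧ IsLUB D x}

theorem stmt0 [PartialOrder P] (r : P → P → Prop) (hr : IsAux r)
    {ι : Type*} (A B : ι → Set P)
    (hA : ∀ i, IsLowerSet (A i)) (hB : ∀ i, IsUpperSet (B i)) :
    uap r (⋂ i, A i) = ⋂ i, uap r (A i) ∧
    lap r (⋃ i, B i) = ⋃ i, lap r (B i) := by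
  constructor
  · ext x
    simp only [Set.mem_iInter]
    constructor
    · intro h i y hy
      obtain ⟨a, ha, hya⟩ := h hy
      exact ⟨a, Set.mem_iInter.1 ha i, hya⟩
    · intro h y hy
      refine ⟨y, Set.mem_iInter.2 fun i => ?_, le_rfl⟩
      obtain ⟨a, ha, hya⟩ := h i hy
      exact hA i hya ha
  · ext x
    simp only [Set.mem_iUnion]
    constructor
    · rintro ⟨_, y, hy, hyB⟩
      obtain ⟨i, hi⟩ := Set.mem_iUnion.1 hyB
      exact ⟨i, hB i (hr.1 y x hy) hi, y, hy, hi⟩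
    · rintro ⟨i, hx, y, hy, hyB⟩
      exact ⟨Set.mem_iUnion.2 ⟨i, hx⟩, y, hy, Set.mem_iUnion.2 ⟨i, hyB⟩⟩

end RoughDomain
end

section
/- Let P be a poset, ≺ an auxiliary relation on P, and A ⊆ P. Then (1) A^{↓≺} ∪ (P \ A)^{↑≺} = P; and (2) if in addition A is an upper set of P, then A^{↓≺} ∩ (P \ A)^{↑≺} = ∅, so that A^{↓≺} and (P \ A)^{↑≺} form a partition of P. -/
namespace RoughDomain

variable {P : Type*}

theorem stmt1 [PartialOrder P] (r : P → P → Prop) (hr : IsAux r) (A : Set P) :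
    lap r A ∪ uap r Aᶜ = Set.univ ∧
    (IsUpperSet A → lap r A ∩ uap r Aᶜ = ∅) := by
  constructor
  · refine Set.eq_univ_of_forall fun x => ?_
    by_cases hx : x ∈ lap r A
    · exact Or.inl hx
    · refine Or.inr fun y hy => ?_
      by_cases hxA : x ∈ A
      · exact ⟨y, fun hyA => hx ⟨hxA, y, hy, hyA⟩, le_refl y⟩
      · exact ⟨x, hxA, hr.1 y x hy⟩
  · intro hA
    refine Set.eq_empty_of_forall_notMem ?_
    rintro x ⟨⟨_, y, hy, hyA⟩, hu⟩
    obtain ⟨a, ha, hya⟩ := hu hy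
    exact ha (hA hya hyA)

end RoughDomain
end

section
/- Let P be a poset and ≺ an auxiliary relation on P. Then the following are equivalent: (1) ≺ satisfies the interpolation property (INT); (2) (A^{↓≺})^{↓≺} = A^{↓≺} for every upper set A of P; (3) the map A ↦ A^{↓≺} is a kernel operator (a monotone idempotent self-map below the identity) on the complete lattice of upper sets of P ordered by inclusion; (4) (B^{↑≺})^{↑≺} = B^{↑≺} for every lower set B of P; (5) the map B ↦ B^{↑≺} is a closure operator (a monotone idempotent self-map above the identity) on the complete lattice of lower sets of P ordered by inclusion. -/
namespace RoughDomain

variable {P : Type*}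

theorem stmt2 [PartialOrder P] (r : P → P → Prop) (hr : IsAux r) :
    List.TFAE [
      -- (1) `≺` satisfies the interpolation property (INT)
      ∀ x z : P, r x z → ∃ y, r x y ∧ r y z,
      -- (2) idempotence of the lower approximation on upper sets
      ∀ A : Set P, IsUpperSet A → lap r (lap r A) = lap r A,
      -- (3) the lower approximation is a kernel operator on the lattice of upper sets
      (∀ A : Set P, IsUpperSet A →
        IsUpperSet (lap r A) ∧ lap r A ⊆ A ∧ lap r (lap r A) = lap r A) ∧
      (∀ A B : Set P, IsUpperSet A → IsUpperSet B → A ⊆ B → lap r A ⊆ lap r B),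
      -- (4) idempotence of the upper approximation on lower sets
      ∀ B : Set P, IsLowerSet B → uap r (uap r B) = uap r B,
      -- (5) the upper approximation is a closure operator on the lattice of lower sets
      (∀ B : Set P, IsLowerSet B →
        IsLowerSet (uap r B) ∧ B ⊆ uap r B ∧ uap r (uap r B) = uap r B) ∧
      (∀ A B : Set P, IsLowerSet A → IsLowerSet B → A ⊆ B → uap r A ⊆ uap r B)
    ] := by
  obtain ⟨hle, hmono, -⟩ := hr
  have hU : ∀ A : Set P, IsUpperSet A → IsUpperSet (lap r A) := by
    rintro A hA a b hab ⟨ha, y, hy, hyA⟩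
    exact ⟨hA hab ha, y, hmono y y a b le_rfl hy hab, hyA⟩
  have hL : ∀ B : Set P, IsLowerSet (uap r B) := by
    intro B a b hba ha y hy
    exact ha (hmono y y b a le_rfl hy hba)
  have hsub : ∀ B : Set P, B ⊆ uap r B := fun B x hx y hy => ⟨x, hx, hle y x hy⟩
  tfae_have 1 → 2 := by
    intro h A hA
    refine Set.Subset.antisymm (lap_subset r _) ?_
    rintro x ⟨hx, y, hy, hyA⟩
    obtain ⟨w, h1, h2⟩ := h y x hy
    exact ⟨⟨hx, y, hy, hyA⟩, w, h2, hA (hle _ _ h1) hyA, y, h1, hyA⟩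
  tfae_have 2 → 1 := by
    intro h x z hxz
    have hz : z ∈ lap r (Set.Ici x) := ⟨hle _ _ hxz, x, hxz, le_rfl⟩
    rw [← h _ (isUpperSet_Ici x)] at hz
    obtain ⟨-, w, hw, -, v, hv, hxv⟩ := hz
    exact ⟨w, hmono x v w w hxv hv le_rfl, hw⟩
  tfae_have 2 → 3 := by
    intro h
    refine ⟨fun A hA => ⟨hU A hA, lap_subset r A, h A hA⟩, ?_⟩
    rintro A B - - hAB x ⟨hx, y, hy, hyA⟩
    exact ⟨hAB hx, y, hy, hAB hyA⟩
  tfae_have 3 → 2 := fun h A hA => (h.1 A hA).2.2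
  tfae_have 1 → 4 := by
    intro h B hB
    refine Set.Subset.antisymm ?_ (hsub _)
    intro x hx y hy
    obtain ⟨w, h1, h2⟩ := h y x hy
    obtain ⟨a, ha, hwa⟩ := hx h2
    exact ha (hmono y y w a le_rfl h1 hwa)
  tfae_have 4 → 1 := by
    intro h x z hxz
    by_contra hn
    have hB : IsLowerSet {y : P | ¬ x ≤ y} := fun a b hba ha hb => ha (hb.trans hba)
    have hz : z ∈ uap r (uap r {y : P | ¬ x ≤ y}) := by
      intro w hw
      refine ⟨w, fun v hv => ⟨v, fun hxv => hn ⟨w, ?_, hw⟩, le_rfl⟩, le_rfl⟩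
      exact hmono x v w w hxv hv le_rfl
    rw [h _ hB] at hz
    obtain ⟨a, ha, hxa⟩ := hz hxz
    exact ha hxa
  tfae_have 4 → 5 := by
    intro h
    refine ⟨fun B hB => ⟨hL B, hsub B, h B hB⟩, ?_⟩
    intro A B _ _ hAB x hx y hy
    obtain ⟨a, ha, hya⟩ := hx hy
    exact ⟨a, hAB ha, hya⟩
  tfae_have 5 → 4 := fun h B hB => (h.1 B hB).2.2
  tfae_finish

end RoughDomain
end

section
/- Let P be a poset, A ⊆ P, and ≺₁, ≺₂ auxiliary relations on P. Then (1) A^{↑≺₁} ∩ A^{↑≺₂} = A^{↑(≺₁∪≺₂)}; (2) A^{↓≺₁} ∪ A^{↓≺₂} = A^{↓(≺₁∪≺₂)}; and (3) if A is filtered (nonempty and every pair of elements of A has a lower bound in A), then A^{↓≺₁} ∩ A^{↓≺₂} = A^{↓(≺₁∩≺₂)}. -/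
namespace RoughDomain

variable {P : Type*}

theorem stmt3 [PartialOrder P] (r₁ r₂ : P → P → Prop)
    (h₁ : IsAux r₁) (h₂ : IsAux r₂) (A : Set P) :
    uap r₁ A ∩ uap r₂ A = uap (fun a b => r₁ a b ∨ r₂ a b) A ∧
    lap r₁ A ∪ lap r₂ A = lap (fun a b => r₁ a b ∨ r₂ a b) A ∧
    (A.Nonempty → DirectedOn (· ≥ ·) A →
      lap r₁ A ∩ lap r₂ A = lap (fun a b => r₁ a b ∧ r₂ a b) A) := by
  refine ⟨?_, ?_, ?_⟩
  · ext x
    constructor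
    · rintro ⟨ha, hb⟩ y (hy | hy)
      · exact ha hy
      · exact hb hy
    · intro h
      exact ⟨fun y hy => h (Or.inl hy), fun y hy => h (Or.inr hy)⟩
  · ext x
    constructor
    · rintro (⟨hx, y, hy, hyA⟩ | ⟨hx, y, hy, hyA⟩)
      · exact ⟨hx, y, Or.inl hy, hyA⟩
      · exact ⟨hx, y, Or.inr hy, hyA⟩
    · rintro ⟨hx, y, hy | hy, hyA⟩
      · exact Or.inl ⟨hx, y, hy, hyA⟩
      · exact Or.inr ⟨hx, y, hy, hyA⟩
  · intro _ hd
    ext x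
    constructor
    · rintro ⟨⟨hx, y, hy, hyA⟩, ⟨_, z, hz, hzA⟩⟩
      obtain ⟨w, hwA, hwy, hwz⟩ := hd y hyA z hzA
      exact ⟨hx, w, ⟨h₁.2.1 w y x x hwy hy le_rfl, h₂.2.1 w z x x hwz hz le_rfl⟩, hwA⟩
    · rintro ⟨hx, y, ⟨ha, hb⟩, hyA⟩
      exact ⟨⟨hx, y, ha, hyA⟩, ⟨hx, y, hb, hyA⟩⟩

end RoughDomain
end

section
/- Let P be a poset, U ⊆ P, and ≺ a pre-approximating auxiliary relation on P. (1) If U is ≺-open, then U is an upper set and is inaccessible by existing suprema of sets of the form s_≺(x): whenever sup s_≺(x) exists and lies in U, then s_≺(x) ∩ U ≠ ∅. (2) If moreover ≺ is approximating, then the converse holds: any upper set U inaccessible by existing suprema of sets of the form s_≺(x) is ≺-open. -/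
namespace RoughDomain

variable {P : Type*}

theorem stmt6 [PartialOrder P] (r : P → P → Prop) (h : IsPreApprox r) (U : Set P) :
    (PrecOpen r U →
      IsUpperSet U ∧
        ∀ x a : P, IsLUB (sRel r x) a → a ∈ U → (sRel r x ∩ U).Nonempty) ∧
    (IsApprox r →
      (IsUpperSet U ∧
        ∀ x a : P, IsLUB (sRel r x) a → a ∈ U → (sRel r x ∩ U).Nonempty) →
      PrecOpen r U) := by
  refine ⟨fun ⟨hU, hlap⟩ => ⟨hU, fun x a ha haU => ?_⟩, fun hA ⟨hU, hin⟩ => ⟨hU, ?_⟩⟩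
  · have hax : a ≤ x := ha.2 fun y hy => h.1.1 y x hy
    have hx : x ∈ lap r U := by rw [hlap]; exact hU hax haU
    exact hx.2
  · exact Set.Subset.antisymm (lap_subset r U) fun x hx => ⟨hx, hin x x (hA.2 x) hx⟩

end RoughDomain
end

section
/- Let P be a continuous poset. Then the topology μ^≪(P) induced by the way-below relation coincides with the Scott topology σ(P): a subset of P is Scott open if and only if it is ≪-open. -/
namespace RoughDomain

variable {P : Type*}

theorem stmt8 [PartialOrder P] (hP : IsContinuousPoset P) (U : Set P) :
    ScottOpen U ↔ PrecOpen wb U := by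
  constructor
  · rintro ⟨hU, hD⟩
    refine ⟨hU, Set.Subset.antisymm (lap_subset _ _) fun x hx => ⟨hx, ?_⟩⟩
    exact hD _ (hP x).1 x (hP x).2 hx
  · rintro ⟨hU, hl⟩
    refine ⟨hU, fun D hD a ha haU => ?_⟩
    rw [← hl] at haU
    obtain ⟨_, y, hy, hyU⟩ := haU
    obtain ⟨d, hd, hyd⟩ := hy D hD a ha le_rfl
    exact ⟨d, hd, hU hyd hyU⟩

end RoughDomain
end

section
/- Let P be a poset, A ⊆ P, and ≺ an approximating auxiliary relation on P. Then the following chain of inclusions holds: int_σ(A) ⊆ int_{μ^≺}(A) ⊆ A^{↓≺} ⊆ A ⊆ A^{↑≺} ⊆ cl_{μ^≺}(A) ⊆ cl_σ(A). -/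
namespace RoughDomain

variable {P : Type*}

theorem stmt9 [PartialOrder P] (r : P → P → Prop) (h : IsApprox r) (A : Set P) :
    @interior P (scottTop P) A ⊆ @interior P (muTop r h.1) A ∧
    @interior P (muTop r h.1) A ⊆ lap r A ∧
    lap r A ⊆ A ∧
    A ⊆ uap r A ∧
    uap r A ⊆ @closure P (muTop r h.1) A ∧
    @closure P (muTop r h.1) A ⊆ @closure P (scottTop P) A := by
  have key : ∀ U : Set P, @IsOpen P (scottTop P) U → @IsOpen P (muTop r h.1) U := by
    intro U hU
    refine ⟨hU.1, Set.Subset.antisymm (lap_subset r _) fun x hx => ⟨hx, ?_⟩⟩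
    exact hU.2 _ (h.1.2 x) x (h.2 x) hx
  refine ⟨?_, ?_, lap_subset r A, ?_, ?_, ?_⟩
  · intro x hx
    obtain ⟨V, hVA, hV, hxV⟩ := (@mem_interior P (scottTop P) x A).1 hx
    exact (@mem_interior P (muTop r h.1) x A).2 ⟨V, hVA, key V hV, hxV⟩
  · intro x hx
    obtain ⟨V, hVA, hV, hxV⟩ := (@mem_interior P (muTop r h.1) x A).1 hx
    have h1 : x ∈ lap r V := by rw [hV.2]; exact hxV
    obtain ⟨_, y, hyr, hyV⟩ := h1
    exact ⟨hVA hxV, y, hyr, hVA hyV⟩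
  · intro x hx y hy
    exact ⟨x, hx, h.1.1.1 y x hy⟩
  · intro x hx
    refine (@mem_closure_iff P (muTop r h.1) x A).2 fun U hU hxU => ?_
    have h1 : x ∈ lap r U := by rw [hU.2]; exact hxU
    obtain ⟨_, y, hyr, hyU⟩ := h1
    obtain ⟨a, haA, hya⟩ := hx hyr
    exact ⟨a, hU.1 hya hyU, haA⟩
  · intro x hx
    refine (@mem_closure_iff P (scottTop P) x A).2 fun U hU hxU => ?_
    exact (@mem_closure_iff P (muTop r h.1) x A).1 hx U (key U hU) hxU

end RoughDomain
end

section
/- Let P be a poset and ≺ an approximating auxiliary relation on P such that A^{↓≺} = int_σ(A) for every upper set A of P. Then: (1) the topology μ^≺(P) of ≺-open sets equals the Scott topology σ(P); (2) ≺ coincides with the way-below relation ≪; and (3) P is continuous. -/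
namespace RoughDomain

variable {P : Type*}

theorem stmt10 [PartialOrder P] (r : P → P → Prop) (h : IsApprox r)
    (hint : ∀ A : Set P, IsUpperSet A → lap r A = @interior P (scottTop P) A) :
    muTop r h.1 = scottTop P ∧
    (∀ x y : P, r x y ↔ wb x y) ∧
    IsContinuousPoset P := by
  have key : ∀ x y : P, r x y ↔ wb x y := by
    intro x y
    constructor
    · intro hxy D hD a ha hya
      have hy : y ∈ lap r (Set.Ici x) :=
        ⟨h.1.1.1 x y hxy, x, hxy, le_refl x⟩
      rw [hint _ (isUpperSet_Ici x)] at hy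
      have hO : ScottOpen (@interior P (scottTop P) (Set.Ici x)) :=
        @isOpen_interior P (scottTop P) (Set.Ici x)
      obtain ⟨d, hdD, hd⟩ := hO.2 D hD a ha (hO.1 hya hy)
      exact ⟨d, hdD, @interior_subset P (scottTop P) (Set.Ici x) d hd⟩
    · intro hxy
      obtain ⟨d, hd, hxd⟩ := hxy (sRel r y) (h.1.2 y) y (h.2 y) le_rfl
      exact h.1.1.2.1 x d y y hxd hd le_rfl
  refine ⟨?_, key, ?_⟩
  · refine TopologicalSpace.ext_iff.2 fun U => ?_
    change PrecOpen r U ↔ ScottOpen U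
    constructor
    · rintro ⟨h1, h2⟩
      rw [hint U h1] at h2
      have hO : ScottOpen (@interior P (scottTop P) U) :=
        @isOpen_interior P (scottTop P) U
      rwa [h2] at hO
    · intro hU
      refine ⟨hU.1, ?_⟩
      rw [hint U hU.1]
      exact @IsOpen.interior_eq P (scottTop P) U hU
  · intro x
    have e : {y | wb y x} = sRel r x := Set.ext fun y => (key y x).symm
    rw [e]
    exact ⟨h.1.2 x, h.2 x⟩

end RoughDomain
end

section
/- The following are equivalent for a poset P: (1) P is continuous; (2) A^{↓≪} = int_σ(A) for every upper subset A of P; (3) there exists an approximating auxiliary relation ≺ on P such that A^{↓≺} = int_σ(A) for every upper subset A of P; (4) A^{↑≪} = cl_σ(A) for every lower subset A of P; (5) there exists an approximating auxiliary relation ≺ on P such that A^{↑≺} = cl_σ(A) for every lower subset A of P. -/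
namespace RoughDomain

variable {P : Type*}

lemma isDir_singleton [PartialOrder P] (x : P) : IsDir ({x} : Set P) := by
  refine ⟨⟨x, rfl⟩, ?_⟩
  rintro a rfl b rfl
  exact ⟨_, rfl, le_rfl, le_rfl⟩

lemma wb_le [PartialOrder P] {x y : P} (h : wb x y) : x ≤ y := by
  obtain ⟨d, hd, hxd⟩ := h {y} (isDir_singleton y) y isLUB_singleton le_rfl
  obtain rfl := hd
  exact hxd

lemma wb_mono [PartialOrder P] {u x y z : P} (h1 : u ≤ x) (h : wb x y) (h2 : y ≤ z) :
    wb u z := by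
  intro D hD a ha hza
  obtain ⟨d, hd, hxd⟩ := h D hD a ha (h2.trans hza)
  exact ⟨d, hd, h1.trans hxd⟩

lemma wb_aux [PartialOrder P] : IsAux (wb : P → P → Prop) :=
  ⟨fun _ _ h => wb_le h, fun _ _ _ _ h1 h h2 => wb_mono h1 h h2,
    fun _ hb _ D hD _ _ _ => hD.1.imp fun d hd => ⟨hd, hb d⟩⟩

lemma wb_interp [PartialOrder P] (hP : IsContinuousPoset P) {y a : P} (h : wb y a) :
    ∃ z, wb y z ∧ wb z a := by
  have hdir : IsDir {u : P | ∃ z, wb u z ∧ wb z a} := by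
    constructor
    · obtain ⟨z, hz⟩ := (hP a).1.1
      obtain ⟨u, hu⟩ := (hP z).1.1
      exact ⟨u, z, hu, hz⟩
    · rintro u1 ⟨z1, hu1, hz1⟩ u2 ⟨z2, hu2, hz2⟩
      obtain ⟨z, hz, h1, h2⟩ := (hP a).1.2 z1 hz1 z2 hz2
      obtain ⟨u, hu, h3, h4⟩ := (hP z).1.2 u1 (wb_mono le_rfl hu1 h1) u2 (wb_mono le_rfl hu2 h2)
      exact ⟨u, ⟨z, hu, hz⟩, h3, h4⟩
  have hlub : IsLUB {u : P | ∃ z, wb u z ∧ wb z a} a := by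
    constructor
    · rintro u ⟨z, hu, hz⟩
      exact (wb_le hu).trans (wb_le hz)
    · intro b hb
      refine (hP a).2.2 fun z hz => ?_
      exact (hP z).2.2 fun u hu => hb ⟨z, hu, hz⟩
  obtain ⟨u, ⟨z, hu, hz⟩, hyu⟩ := h _ hdir a hlub le_rfl
  exact ⟨z, wb_mono hyu hu le_rfl, hz⟩

lemma mem_int [PartialOrder P] {A : Set P} {x : P} :
    x ∈ @interior P (scottTop P) A ↔ ∃ U, U ⊆ A ∧ ScottOpen U ∧ x ∈ U :=
  @mem_interior P (scottTop P) x A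

lemma wb_of_int [PartialOrder P] {y x : P}
    (h : x ∈ @interior P (scottTop P) (Set.Ici y)) : wb y x := by
  obtain ⟨U, hU, hUo, hx⟩ := mem_int.1 h
  intro D hD a ha hxa
  obtain ⟨d, hd, hdU⟩ := hUo.2 D hD a ha (hUo.1 hxa hx)
  exact ⟨d, hd, hU hdU⟩

lemma cont_lap [PartialOrder P] (hP : IsContinuousPoset P) (A : Set P) (hA : IsUpperSet A) :
    lap wb A = @interior P (scottTop P) A := by
  ext x
  rw [mem_int]
  constructor
  · intro hx
    refine ⟨lap wb A, lap_subset _ _, ⟨?_, ?_⟩, hx⟩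
    · rintro a b hab ⟨ha, y, hy, hyA⟩
      exact ⟨hA hab ha, y, wb_mono le_rfl hy hab, hyA⟩
    · rintro D hD a ha ⟨_, y, hy, hyA⟩
      obtain ⟨z, hyz, hza⟩ := wb_interp hP hy
      obtain ⟨d, hd, hzd⟩ := hza D hD a ha le_rfl
      exact ⟨d, hd, hA ((wb_le hyz).trans hzd) hyA, y, wb_mono le_rfl hyz hzd, hyA⟩
  · rintro ⟨U, hU, hUo, hx⟩
    obtain ⟨d, hd, hdU⟩ := hUo.2 _ (hP x).1 x (hP x).2 hx
    exact ⟨hU hx, d, hd, hU hdU⟩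

lemma lap_cont [PartialOrder P]
    (h : ∀ A : Set P, IsUpperSet A → lap wb A = @interior P (scottTop P) A) :
    IsContinuousPoset P := by
  intro x
  refine ⟨⟨?_, ?_⟩, fun y hy => wb_le hy, ?_⟩
  · have hx : x ∈ lap wb (Set.univ : Set P) := by
      rw [h _ isUpperSet_univ]
      exact mem_int.2 ⟨_, subset_rfl, (scottTop P).isOpen_univ, trivial⟩
    exact hx.2.imp fun y hy => hy.1
  · intro y1 h1 y2 h2
    have e : ∀ y, wb y x → x ∈ @interior P (scottTop P) (Set.Ici y) := by
      intro y hy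
      rw [← h _ (isUpperSet_Ici y)]
      exact ⟨wb_le hy, y, hy, le_rfl⟩
    have hx : x ∈ lap wb (Set.Ici y1 ∩ Set.Ici y2) := by
      rw [h _ ((isUpperSet_Ici y1).inter (isUpperSet_Ici y2)), @interior_inter P (scottTop P)]
      exact ⟨e y1 h1, e y2 h2⟩
    obtain ⟨z, hz, hz1, hz2⟩ := hx.2
    exact ⟨z, hz, hz1, hz2⟩
  · intro u hu
    by_contra hxu
    have hup : IsUpperSet (Set.Iic u)ᶜ := (isLowerSet_Iic u).compl
    have hx : x ∈ lap wb (Set.Iic u)ᶜ := by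
      rw [h _ hup]
      refine mem_int.2 ⟨_, subset_rfl, ⟨hup, fun D hD a ha haU => ?_⟩, hxu⟩
      by_contra hn
      refine haU (ha.2 fun d hd => ?_)
      by_contra hdu
      exact hn ⟨d, hd, hdu⟩
    obtain ⟨z, hz, hzu⟩ := hx.2
    exact hzu (hu hz)

lemma uap_eq [PartialOrder P] (r : P → P → Prop) (hr : ∀ x y, r x y → x ≤ y) (A : Set P)
    (hA : IsLowerSet A) : uap r A = (lap r Aᶜ)ᶜ := by
  have hd : dcl A = A :=
    Set.Subset.antisymm (fun z ⟨_, ha, hz⟩ => hA hz ha) fun z hz => ⟨z, hz, le_rfl⟩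
  ext x
  constructor
  · rintro h ⟨_, y, hy, hyA⟩
    exact hyA (hd ▸ h hy)
  · intro h y hy
    rw [hd]
    by_contra hyA
    exact h ⟨fun hx => hyA (hA (hr _ _ hy) hx), y, hy, hyA⟩

lemma dual_iff [PartialOrder P] (r : P → P → Prop) (hr : ∀ x y, r x y → x ≤ y) :
    (∀ A : Set P, IsUpperSet A → lap r A = @interior P (scottTop P) A) ↔
    (∀ A : Set P, IsLowerSet A → uap r A = @closure P (scottTop P) A) := by
  constructor
  · intro h A hA
    rw [uap_eq r hr A hA, h _ hA.compl, @interior_compl P (scottTop P), compl_compl]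
  · intro h A hA
    have h1 := h _ hA.compl
    rw [uap_eq r hr _ hA.compl, compl_compl, @closure_compl P (scottTop P)] at h1
    exact compl_injective h1

theorem stmt11 [PartialOrder P] :
    List.TFAE [
      -- (1) P is continuous
      IsContinuousPoset P,
      -- (2)
      ∀ A : Set P, IsUpperSet A → lap wb A = @interior P (scottTop P) A,
      -- (3)
      ∃ r : P → P → Prop, IsApprox r ∧
        ∀ A : Set P, IsUpperSet A → lap r A = @interior P (scottTop P) A,
      -- (4)
      ∀ A : Set P, IsLowerSet A → uap wb A = @closure P (scottTop P) A,
      -- (5)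
      ∃ r : P → P → Prop, IsApprox r ∧
        ∀ A : Set P, IsLowerSet A → uap r A = @closure P (scottTop P) A
    ] := by
  tfae_have 1 → 2 := cont_lap
  tfae_have 2 → 1 := lap_cont
  tfae_have 1 → 3 := fun h => ⟨wb, ⟨⟨wb_aux, fun x => (h x).1⟩, fun x => (h x).2⟩, cont_lap h⟩
  tfae_have 3 → 1 := by
    rintro ⟨r, hr, h⟩
    have e : ∀ x, sRel r x = {y | wb y x} := by
      intro x
      ext y
      constructor
      · intro hy
        refine wb_of_int ?_
        rw [← h _ (isUpperSet_Ici y)]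
        exact ⟨hr.1.1.1 _ _ hy, y, hy, le_rfl⟩
      · intro hy
        obtain ⟨d, hd, hyd⟩ := hy _ (hr.1.2 x) x (hr.2 x) le_rfl
        exact hr.1.1.2.1 _ _ _ _ hyd hd le_rfl
    intro x
    rw [← e]
    exact ⟨hr.1.2 x, hr.2 x⟩
  tfae_have 2 ↔ 4 := dual_iff wb fun _ _ h => wb_le h
  tfae_have 3 ↔ 5 := exists_congr fun r => and_congr_right fun hr => dual_iff r hr.1.1.1
  tfae_finish

end RoughDomain
end

section
/- Every poset having one-step closure is meet continuous: if P is a poset such that A' = cl_σ(A) for every A ⊆ P, then for every x ∈ P and every directed D ⊆ P whose supremum exists with x ≤ sup D, one has x ∈ cl_σ(↓D ∩ ↓x). -/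
namespace RoughDomain

variable {P : Type*}

theorem stmt18 [PartialOrder P]
    (hP : ∀ A : Set P, oneStep A = @closure P (scottTop P) A)
    (x : P) (D : Set P) (hD : IsDir D) (a : P) (ha : IsLUB D a) (hx : x ≤ a) :
    x ∈ @closure P (scottTop P) (dcl D ∩ dcl {x}) := by
  have h1 : a ∈ @closure P (scottTop P) D := by
    rw [← hP]
    exact ⟨D, hD, fun d hd => ⟨d, hd, le_rfl⟩, ha⟩
  have h2 : x ∈ @closure P (scottTop P) D := by
    rw [@mem_closure_iff P (scottTop P)] at h1 ⊢
    intro U hU hxU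
    have hU' : ScottOpen U := hU
    exact h1 U hU (hU'.1 hx hxU)
  rw [← hP] at h2 ⊢
  obtain ⟨E, hE, hED, hEx⟩ := h2
  exact ⟨E, hE, fun e he => ⟨e, ⟨hED he, x, rfl, hEx.1 he⟩, le_rfl⟩, hEx⟩

end RoughDomain
end

section
/- Let P be a poset that has one-step closure. Then for each x ∈ P, the Scott interior of the principal upper set ↑x equals ↟x = {y ∈ P : x ≪ y}. -/
namespace RoughDomain

variable {P : Type*}

theorem stmt19 [PartialOrder P]
    (hP : ∀ A : Set P, oneStep A = @closure P (scottTop P) A) (x : P) :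
    @interior P (scottTop P) {y | x ≤ y} = {y | wb x y} := by
  letI := scottTop P
  ext y
  constructor
  · intro hy D hD a ha hya
    have ho : ScottOpen (interior {y : P | x ≤ y}) :=
      (isOpen_interior : IsOpen (interior {y : P | x ≤ y}))
    obtain ⟨d, hdD, hd⟩ := ho.2 D hD a ha (ho.1 hya hy)
    exact ⟨d, hdD, (interior_subset hd : x ≤ d)⟩
  · intro hy
    rw [interior_eq_compl_closure_compl, ← hP]
    rintro ⟨D, hD, hDA, hlub⟩
    obtain ⟨d, hdD, hxd⟩ := hy D hD y hlub le_rfl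
    obtain ⟨a, haA, hda⟩ := hDA hdD
    exact haA (hxd.trans hda)


end RoughDomain
end
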